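/- arXiv:1612.08001 — 4 statements merged into one kernel-verified Lean document; each statement's English description precedes it below -/
import Mathlib

section
/- Fix i ∈ {1, …, n−1} and define new elements by the substitution s_i: h̃'_j = h̃_{s_i(j)} where s_i is the transposition (i, i+1); Z'^i = −Z^{i+1} h̃_{i,i+1}, Z'^{i+1} = Z^i h̃_{i,i+1}^{−1}, Z'^j = Z^j for j ≠ i, i+1; ∂'_i = −h̃_{i,i+1}^{−1} ∂_{i+1}, ∂'_{i+1} = h̃_{i,i+1} ∂_i, ∂'_j = ∂_j for j ≠ i, i+1. Then the elements h̃'_j, Z'^j, ∂'_j satisfy all the defining relations of Diff_h(n) listed in the context; that is, the symmetric group generator s_i acts by an endomorphism respecting the relations of the ring Diff_h(n). -/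
open Finset

theorem hx_comm_inv {A : Type*} [Ring A] {a b : A} (h : Commute a b) :
    Commute a (Ring.inverse b) := by
  by_cases hb : IsUnit b
  · obtain ⟨u, rfl⟩ := hb
    rw [Ring.inverse_unit]
    exact h.units_inv_right
  · rw [Ring.inverse_non_unit _ hb]
    exact Commute.zero_right a

theorem hx_gen {A : Type*} [Ring A] {a b c z w : A} (h1 : Commute z b) (h2 : Commute w a)
    (h3 : Commute a b) (h4 : Commute c a) (h5 : Commute c b) (h : z * w = c * (w * z)) :
    (a * z) * (b * w) = c * ((b * w) * (a * z)) := by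
  calc (a * z) * (b * w) = a * (z * b) * w := by noncomm_ring
    _ = (a * b) * (z * w) := by rw [h1.eq]; noncomm_ring
    _ = (b * a) * (c * (w * z)) := by rw [h, h3.eq]
    _ = b * (a * c) * (w * z) := by noncomm_ring
    _ = (b * c) * (a * w) * z := by rw [← h4.eq]; noncomm_ring
    _ = c * ((b * w) * (a * z)) := by rw [← h5.eq, ← h2.eq]; noncomm_ring

theorem hx_inv_shift {A : Type*} [Ring A] {z x w : A} (hx : IsUnit x) (hw : IsUnit w)
    (h : z * x = w * z) : z * Ring.inverse x = Ring.inverse w * z := by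
  calc z * Ring.inverse x = Ring.inverse w * w * z * Ring.inverse x := by
        rw [Ring.inverse_mul_cancel _ hw, one_mul]
    _ = Ring.inverse w * (w * z) * Ring.inverse x := by noncomm_ring
    _ = Ring.inverse w * z * (x * Ring.inverse x) := by rw [← h]; noncomm_ring
    _ = _ := by rw [Ring.mul_inverse_cancel _ hx, mul_one]

theorem stmt13 {k A : Type*} [Field k] [CharZero k] [Ring A] [Algebra k A]
    {n : ℕ} (hn : 1 ≤ n) (h Z D : Fin n → A)
    (hcomm : ∀ i j, h i * h j = h j * h i)
    (hunit : ∀ (i j : Fin n) (m : ℤ), i ≠ j → IsUnit (h i - h j + (m : A)))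
    (hhZ : ∀ i j, h i * Z j = Z j * (h i + if i = j then 1 else 0))
    (hhD : ∀ i j, h i * D j = D j * (h i - if i = j then 1 else 0))
    (hZZ : ∀ i j, i < j →
      Z i * Z j = (h i - h j + 1) * Ring.inverse (h i - h j) * (Z j * Z i))
    (hDD : ∀ i j, i < j →
      D i * D j = (h i - h j - 1) * Ring.inverse (h i - h j) * (D j * D i))
    (hZD : ∀ i j, i < j → Z i * D j = D j * Z i)
    (hZD' : ∀ i j, j < i → Z i * D j =
      (h i - h j) * (h i - h j - 2) * (Ring.inverse (h i - h j - 1)) ^ 2 * (D j * Z i))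
    (hZDdiag : ∀ i, Z i * D i =
      (∑ j, Ring.inverse (1 - (h i - h j)) * (D j * Z j)) - 1)
    (i j : Fin n) (hij : (i : ℕ) + 1 = (j : ℕ)) :
    ∀ h' Z' D' : Fin n → A,
      h' = (fun m => h (Equiv.swap i j m)) →
      Z' = (fun m => if m = i then -(Z j * (h i - h j))
            else if m = j then Z i * Ring.inverse (h i - h j) else Z m) →
      D' = (fun m => if m = i then -(Ring.inverse (h i - h j) * D j)
            else if m = j then (h i - h j) * D i else D m) →
      (∀ p q, h' p * h' q = h' q * h' p) ∧
      (∀ p q, h' p * Z' q = Z' q * (h' p + if p = q then 1 else 0)) ∧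
      (∀ p q, h' p * D' q = D' q * (h' p - if p = q then 1 else 0)) ∧
      (∀ p q, p < q → Z' p * Z' q =
        (h' p - h' q + 1) * Ring.inverse (h' p - h' q) * (Z' q * Z' p)) ∧
      (∀ p q, p < q → D' p * D' q =
        (h' p - h' q - 1) * Ring.inverse (h' p - h' q) * (D' q * D' p)) ∧
      (∀ p q, p < q → Z' p * D' q = D' q * Z' p) ∧
      (∀ p q, q < p → Z' p * D' q =
        (h' p - h' q) * (h' p - h' q - 2) * (Ring.inverse (h' p - h' q - 1)) ^ 2 * (D' q * Z' p)) ∧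
      (∀ p, Z' p * D' p = (∑ q, Ring.inverse (1 - (h' p - h' q)) * (D' q * Z' q)) - 1) := by
  intro h' Z' D' eh eZ eD
  have hne : i ≠ j := by intro e; rw [e] at hij; omega
  have hne' : j ≠ i := hne.symm
  have hlt : i < j := by rw [Fin.lt_def]; omega
  obtain ⟨x, hx⟩ : ∃ x, x = h i - h j := ⟨_, rfl⟩
  have ux : ∀ m : ℤ, IsUnit (x + (m : A)) := fun m => hx ▸ hunit i j m hne
  have ux0 : IsUnit x := by simpa using ux 0
  have ux1 : IsUnit (x + 1) := by simpa using ux 1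
  have uxm : IsUnit (x - 1) := by simpa [sub_eq_add_neg] using ux (-1)
  have uxm2 : IsUnit (x - 2) := by simpa [sub_eq_add_neg] using ux (-2)
  have Zx : ∀ m, m ≠ i → m ≠ j → Commute (Z m) x := by
    intro m h1 h2
    have e1 := hhZ i m
    have e2 := hhZ j m
    rw [if_neg h1.symm, add_zero] at e1
    rw [if_neg h2.symm, add_zero] at e2
    rw [hx]
    exact (show Commute (Z m) (h i) from e1.symm).sub_right e2.symm
  have Dx : ∀ m, m ≠ i → m ≠ j → Commute (D m) x := by
    intro m h1 h2
    have e1 := hhD i m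
    have e2 := hhD j m
    rw [if_neg h1.symm, sub_zero] at e1
    rw [if_neg h2.symm, sub_zero] at e2
    rw [hx]
    exact (show Commute (D m) (h i) from e1.symm).sub_right e2.symm
  have Zix : Z i * x = (x - 1) * Z i := by
    have e1 := hhZ i i
    have e2 := hhZ j i
    rw [if_pos rfl] at e1
    rw [if_neg hne', add_zero] at e2
    rw [hx, sub_mul, sub_mul, e1, e2]; noncomm_ring
  have Zjx : Z j * x = (x + 1) * Z j := by
    have e1 := hhZ i j
    have e2 := hhZ j j
    rw [if_pos rfl] at e2
    rw [if_neg hne, add_zero] at e1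
    rw [hx, add_mul, sub_mul, e1, e2]; noncomm_ring
  have Dix : D i * x = (x + 1) * D i := by
    have e1 := hhD i i
    have e2 := hhD j i
    rw [if_pos rfl] at e1
    rw [if_neg hne', sub_zero] at e2
    rw [hx, add_mul, sub_mul, e1, e2]; noncomm_ring
  have Djx : D j * x = (x - 1) * D j := by
    have e1 := hhD i j
    have e2 := hhD j j
    rw [if_pos rfl] at e2
    rw [if_neg hne, sub_zero] at e1
    rw [hx, sub_mul, sub_mul, e1, e2]; noncomm_ring
  have Djx1 : D j * (x + 1) = x * D j := by rw [mul_add, Djx]; noncomm_ring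
  have Dixm : D i * (x - 1) = x * D i := by rw [mul_sub, Dix]; noncomm_ring
  have Ziy := hx_inv_shift ux0 uxm Zix
  have Dixmy := hx_inv_shift uxm ux0 Dixm
  have Djxmy : D j * Ring.inverse (x - 1) = Ring.inverse (x - 2) * D j := by
    apply hx_inv_shift uxm uxm2
    rw [mul_sub, Djx]; noncomm_ring
  obtain ⟨s, hs⟩ : ∃ s, s = Equiv.swap i j := ⟨_, rfl⟩
  have si : s i = j := by rw [hs]; exact Equiv.swap_apply_left i j
  have sj : s j = i := by rw [hs]; exact Equiv.swap_apply_right i j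
  have sm : ∀ m, m ≠ i → m ≠ j → s m = m := by
    intro m h1 h2; rw [hs]; exact Equiv.swap_apply_of_ne_of_ne h1 h2
  obtain ⟨a, ha⟩ : ∃ a : Fin n → A, a = fun m => if m = i then -(x + 1) else
    if m = j then Ring.inverse (x - 1) else 1 := ⟨_, rfl⟩
  obtain ⟨b, hb⟩ : ∃ b : Fin n → A, b = fun m => if m = i then -(Ring.inverse x) else
    if m = j then x else 1 := ⟨_, rfl⟩
  have ai : a i = -(x + 1) := by simp [ha]
  have aj : a j = Ring.inverse (x - 1) := by simp [ha, hne']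
  have am : ∀ m, m ≠ i → m ≠ j → a m = 1 := by intro m h1 h2; simp [ha, h1, h2]
  have bi : b i = -(Ring.inverse x) := by simp [hb]
  have bj : b j = x := by simp [hb, hne']
  have bm : ∀ m, m ≠ i → m ≠ j → b m = 1 := by intro m h1 h2; simp [hb, h1, h2]
  have Ca : ∀ t m, Commute t x → Commute t (a m) := by
    intro t m ht
    rw [ha]; dsimp only
    split_ifs
    · exact (ht.add_right (Commute.one_right _)).neg_right
    · exact hx_comm_inv (ht.sub_right (Commute.one_right _))
    · exact Commute.one_right _
  have Cb : ∀ t m, Commute t x → Commute t (b m) := by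
    intro t m ht
    rw [hb]; dsimp only
    split_ifs
    · exact (hx_comm_inv ht).neg_right
    · exact ht
    · exact Commute.one_right _
  have hxc : ∀ p, Commute (h p) x := by
    intro p; rw [hx]
    exact (show Commute (h p) (h i) from hcomm _ _).sub_right (hcomm _ _)
  have ax : ∀ m, Commute (a m) x := fun m => (Ca x m (Commute.refl x)).symm
  have bx : ∀ m, Commute (b m) x := fun m => (Cb x m (Commute.refl x)).symm
  have dx : ∀ p q, Commute x (h p - h q) := fun p q => ((hxc p).sub_left (hxc q)).symm
  have h'e : ∀ m, h' m = h (s m) := by intro m; rw [eh, hs]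
  have Z'e : ∀ m, Z' m = a m * Z (s m) := by
    intro m
    rw [eZ]; dsimp only
    rw [← hx]
    by_cases h1 : m = i
    · subst h1; rw [if_pos rfl, ai, si, Zjx, neg_mul]
    · by_cases h2 : m = j
      · subst h2; rw [if_neg h1, if_pos rfl, aj, sj, Ziy]
      · rw [if_neg h1, if_neg h2, am m h1 h2, sm m h1 h2, one_mul]
  have D'e : ∀ m, D' m = b m * D (s m) := by
    intro m
    rw [eD]; dsimp only
    rw [← hx]
    by_cases h1 : m = i
    · subst h1; rw [if_pos rfl, bi, si, neg_mul]
    · by_cases h2 : m = j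
      · subst h2; rw [if_neg h1, if_pos rfl, bj, sj]
      · rw [if_neg h1, if_neg h2, bm m h1 h2, sm m h1 h2, one_mul]
  clear eh eZ eD
  -- a pair of distinct indices is either {i, j} or contains a third index
  have key : ∀ p q : Fin n, p < q → (p = i ∧ q = j) ∨
      (s p < s q ∧ ((p ≠ i ∧ p ≠ j) ∨ (q ≠ i ∧ q ≠ j))) := by
    intro p q hpq
    by_cases p1 : p = i
    · by_cases q2 : q = j
      · exact Or.inl ⟨p1, q2⟩
      · have q1 : q ≠ i := by rintro rfl; exact absurd hpq (by simp [p1])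
        refine Or.inr ⟨?_, Or.inr ⟨q1, q2⟩⟩
        rw [p1, si, sm q q1 q2]
        have : (q : ℕ) ≠ j := fun e => q2 (Fin.ext e)
        rw [p1] at hpq
        rw [Fin.lt_def] at *; omega
    · by_cases p2 : p = j
      · have q1 : q ≠ i := by rintro rfl; rw [p2] at hpq; exact absurd hpq (lt_asymm hlt)
        have q2 : q ≠ j := by rintro rfl; exact absurd hpq (by simp [p2])
        refine Or.inr ⟨?_, Or.inr ⟨q1, q2⟩⟩
        rw [p2, sj, sm q q1 q2]
        rw [p2] at hpq
        exact hlt.trans hpq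
      · refine Or.inr ⟨?_, Or.inl ⟨p1, p2⟩⟩
        rw [sm p p1 p2]
        by_cases q1 : q = i
        · rw [q1, si]; rw [q1] at hpq; exact hpq.trans hlt
        · by_cases q2 : q = j
          · rw [q2, sj]; rw [q2] at hpq
            have : (p : ℕ) ≠ i := fun e => p1 (Fin.ext e)
            rw [Fin.lt_def] at *; omega
          · rwa [sm q q1 q2]
  have fZa : ∀ p q, ((p ≠ i ∧ p ≠ j) ∨ (q ≠ i ∧ q ≠ j)) → Commute (Z (s p)) (a q) := by
    rintro p q (⟨h1, h2⟩ | ⟨h1, h2⟩)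
    · rw [sm p h1 h2]; exact Ca _ _ (Zx p h1 h2)
    · rw [am q h1 h2]; exact Commute.one_right _
  have fZb : ∀ p q, ((p ≠ i ∧ p ≠ j) ∨ (q ≠ i ∧ q ≠ j)) → Commute (Z (s p)) (b q) := by
    rintro p q (⟨h1, h2⟩ | ⟨h1, h2⟩)
    · rw [sm p h1 h2]; exact Cb _ _ (Zx p h1 h2)
    · rw [bm q h1 h2]; exact Commute.one_right _
  have fDa : ∀ p q, ((p ≠ i ∧ p ≠ j) ∨ (q ≠ i ∧ q ≠ j)) → Commute (D (s p)) (a q) := by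
    rintro p q (⟨h1, h2⟩ | ⟨h1, h2⟩)
    · rw [sm p h1 h2]; exact Ca _ _ (Dx p h1 h2)
    · rw [am q h1 h2]; exact Commute.one_right _
  have fDb : ∀ p q, ((p ≠ i ∧ p ≠ j) ∨ (q ≠ i ∧ q ≠ j)) → Commute (D (s p)) (b q) := by
    rintro p q (⟨h1, h2⟩ | ⟨h1, h2⟩)
    · rw [sm p h1 h2]; exact Cb _ _ (Dx p h1 h2)
    · rw [bm q h1 h2]; exact Commute.one_right _
  have ix : x * Ring.inverse x = 1 := Ring.mul_inverse_cancel _ ux0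
  have xi : Ring.inverse x * x = 1 := Ring.inverse_mul_cancel _ ux0
  have xmi : Ring.inverse (x - 1) * (x - 1) = 1 := Ring.inverse_mul_cancel _ uxm
  have imx : (x - 1) * Ring.inverse (x - 1) = 1 := Ring.mul_inverse_cancel _ uxm
  have imx2 : (x - 2) * Ring.inverse (x - 2) = 1 := Ring.mul_inverse_cancel _ uxm2
  have x1i : Ring.inverse (x + 1) * (x + 1) = 1 := Ring.inverse_mul_cancel _ ux1
  have i1x : (x + 1) * Ring.inverse (x + 1) = 1 := Ring.mul_inverse_cancel _ ux1
  have Ziy' : Z i * (x + 1) = x * Z i := by rw [mul_add, Zix]; noncomm_ring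
  have Zjxm : Z j * Ring.inverse (x - 1) = Ring.inverse x * Z j := by
    apply hx_inv_shift uxm ux0
    rw [mul_sub, Zjx]; noncomm_ring
  have Diy : D i * Ring.inverse x = Ring.inverse (x + 1) * D i := hx_inv_shift ux0 ux1 Dix
  have inv_neg : ∀ y : A, IsUnit y → Ring.inverse (-y) = -(Ring.inverse y) := by
    rintro y ⟨u, rfl⟩
    rw [← Units.val_neg, Ring.inverse_unit, Ring.inverse_unit]; simp
  have hji : h j - h i = -x := by rw [hx]; abel
  have DZi : D' i * Z' i = D j * Z j := by
    rw [D'e, Z'e, ai, bi, si]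
    calc -(Ring.inverse x) * D j * (-(x + 1) * Z j)
        = Ring.inverse x * (D j * (x + 1)) * Z j := by noncomm_ring
      _ = (Ring.inverse x * x) * (D j * Z j) := by rw [Djx1]; noncomm_ring
      _ = _ := by rw [xi, one_mul]
  have DZj : D' j * Z' j = D i * Z i := by
    rw [D'e, Z'e, aj, bj, sj]
    calc x * D i * (Ring.inverse (x - 1) * Z i)
        = x * (D i * Ring.inverse (x - 1)) * Z i := by noncomm_ring
      _ = (x * Ring.inverse x) * (D i * Z i) := by rw [Dixmy]; noncomm_ring
      _ = _ := by rw [ix, one_mul]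
  have ZDi : Z' i * D' i = Z j * D j := by
    rw [D'e, Z'e, ai, bi, si]
    calc -(x + 1) * Z j * (-(Ring.inverse x) * D j)
        = ((x + 1) * Z j) * Ring.inverse x * D j := by noncomm_ring
      _ = Z j * (x * Ring.inverse x) * D j := by rw [← Zjx]; noncomm_ring
      _ = _ := by rw [ix, mul_one]
  have ZDj : Z' j * D' j = Z i * D i := by
    rw [D'e, Z'e, aj, bj, sj]
    calc Ring.inverse (x - 1) * Z i * (x * D i)
        = Ring.inverse (x - 1) * (Z i * x) * D i := by noncomm_ring
      _ = (Ring.inverse (x - 1) * (x - 1)) * (Z i * D i) := by rw [Zix]; noncomm_ring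
      _ = _ := by rw [xmi, one_mul]
  have DZ : ∀ q, D' q * Z' q = D (s q) * Z (s q) := by
    intro q
    by_cases h1 : q = i
    · rw [h1, DZi, si]
    · by_cases h2 : q = j
      · rw [h2, DZj, sj]
      · rw [D'e, Z'e, am q h1 h2, bm q h1 h2, one_mul, one_mul]
  have ZD : ∀ q, Z' q * D' q = Z (s q) * D (s q) := by
    intro q
    by_cases h1 : q = i
    · rw [h1, ZDi, si]
    · by_cases h2 : q = j
      · rw [h2, ZDj, sj]
      · rw [D'e, Z'e, am q h1 h2, bm q h1 h2, one_mul, one_mul]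
  refine ⟨?_, ?_, ?_, ?_, ?_, ?_, ?_, ?_⟩
  · intro p q; rw [h'e, h'e]; exact hcomm _ _
  · intro p q
    have e := hhZ (s p) (s q)
    simp only [s.injective.eq_iff] at e
    rw [h'e, Z'e, ← mul_assoc, (Ca _ q (hxc (s p))).eq, mul_assoc, e, mul_assoc]
  · intro p q
    have e := hhD (s p) (s q)
    simp only [s.injective.eq_iff] at e
    rw [h'e, D'e, ← mul_assoc, (Cb _ q (hxc (s p))).eq, mul_assoc, e, mul_assoc]
  · intro p q hpq
    rcases key p q hpq with ⟨rfl, rfl⟩ | ⟨hl, ht⟩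
    · have e := hZZ _ _ hlt
      rw [← hx] at e
      rw [h'e, h'e, Z'e, Z'e, ai, aj, si, sj, hji, inv_neg x ux0]
      have L : -(x + 1) * Z q * (Ring.inverse (x - 1) * Z p) = -(Z p * Z q) := by
        calc _ = -((x + 1) * (Z q * Ring.inverse (x - 1)) * Z p) := by noncomm_ring
          _ = _ := by rw [Zjxm, e]; noncomm_ring
      have R : Ring.inverse (x - 1) * Z p * (-(x + 1) * Z q)
          = -(Ring.inverse (x - 1) * x * (Z p * Z q)) := by
        calc _ = -(Ring.inverse (x - 1) * (Z p * (x + 1)) * Z q) := by noncomm_ring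
          _ = _ := by rw [Ziy']; noncomm_ring
      rw [L, R]
      have c1 : Commute (x - 1) (Ring.inverse x) :=
        hx_comm_inv ((Commute.refl x).sub_left (Commute.one_left x))
      have E : (-x + 1) * -(Ring.inverse x) * (Ring.inverse (x - 1) * x) = 1 := by
        calc _ = (x - 1) * Ring.inverse x * (Ring.inverse (x - 1) * x) := by noncomm_ring
          _ = Ring.inverse x * ((x - 1) * Ring.inverse (x - 1)) * x := by
            rw [c1.eq]; noncomm_ring
          _ = 1 := by rw [imx, mul_one, xi]
      rw [mul_neg, ← mul_assoc _ _ (Z p * Z q), E, one_mul]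
    · rw [h'e, h'e, Z'e, Z'e]
      have cx : Commute ((h (s p) - h (s q) + 1) * Ring.inverse (h (s p) - h (s q))) x :=
        (((dx _ _).add_right (Commute.one_right _)).mul_right (hx_comm_inv (dx _ _))).symm
      exact hx_gen (fZa p q ht) (fZa q p ht.symm) (Ca _ _ (ax _)) (Ca _ _ cx) (Ca _ _ cx)
        (hZZ _ _ hl)
  · intro p q hpq
    rcases key p q hpq with ⟨rfl, rfl⟩ | ⟨hl, ht⟩
    · have e := hDD _ _ hlt
      rw [← hx] at e
      rw [h'e, h'e, D'e, D'e, bi, bj, si, sj, hji, inv_neg x ux0]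
      have c1 : Commute (x - 1) (Ring.inverse x) :=
        hx_comm_inv ((Commute.refl x).sub_left (Commute.one_left x))
      have L : -(Ring.inverse x) * D q * (x * D p) = -(D p * D q) := by
        calc _ = -(Ring.inverse x * (D q * x) * D p) := by noncomm_ring
          _ = -(Ring.inverse x * (x - 1) * (D q * D p)) := by rw [Djx]; noncomm_ring
          _ = _ := by rw [← c1.eq, e]
      have R : x * D p * (-(Ring.inverse x) * D q)
          = -(x * Ring.inverse (x + 1) * (D p * D q)) := by
        calc _ = -(x * (D p * Ring.inverse x) * D q) := by noncomm_ring
          _ = _ := by rw [Diy]; noncomm_ring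
      rw [L, R]
      have E : (-x - 1) * -(Ring.inverse x) * (x * Ring.inverse (x + 1)) = 1 := by
        calc _ = (x + 1) * (Ring.inverse x * x) * Ring.inverse (x + 1) := by noncomm_ring
          _ = 1 := by rw [xi, mul_one, i1x]
      rw [mul_neg, ← mul_assoc _ _ (D p * D q), E, one_mul]
    · rw [h'e, h'e, D'e, D'e]
      have cx : Commute ((h (s p) - h (s q) - 1) * Ring.inverse (h (s p) - h (s q))) x :=
        (((dx _ _).sub_right (Commute.one_right _)).mul_right (hx_comm_inv (dx _ _))).symm
      exact hx_gen (fDb p q ht) (fDb q p ht.symm) (Cb _ _ (bx _)) (Cb _ _ cx) (Cb _ _ cx)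
        (hDD _ _ hl)
  · intro p q hpq
    rcases key p q hpq with ⟨rfl, rfl⟩ | ⟨hl, ht⟩
    · have e := hZD' _ _ hlt
      have u1 : -x - 1 = -(x + 1) := by abel
      rw [hji, u1, inv_neg _ ux1] at e
      rw [Z'e, D'e, ai, bj, si, sj]
      have c1 : Commute (x + 1) x := (Commute.refl x).add_left (Commute.one_left x)
      have L : -(x + 1) * Z q * (x * D p) = -((x + 1) * (x + 1) * (Z q * D p)) := by
        calc _ = -((x + 1) * (Z q * x) * D p) := by noncomm_ring
          _ = _ := by rw [Zjx]; noncomm_ring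
      have R : x * D p * (-(x + 1) * Z q) = -(x * (x + 2) * (D p * Z q)) := by
        have : D p * (x + 1) = (x + 2) * D p := by rw [mul_add, Dix]; noncomm_ring
        calc _ = -(x * (D p * (x + 1)) * Z q) := by noncomm_ring
          _ = _ := by rw [this]; noncomm_ring
      rw [L, R, e]
      have E : (x + 1) * (x + 1) * (-x * (-x - 2) * (-(Ring.inverse (x + 1))) ^ 2)
          = x * (x + 2) := by
        calc _ = x * (x + 2) * ((x + 1) * ((x + 1) * Ring.inverse (x + 1)) *
              Ring.inverse (x + 1)) := by noncomm_ring
          _ = _ := by rw [i1x, mul_one, i1x, mul_one]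
      rw [← mul_assoc _ _ (D p * Z q), E]
    · rw [Z'e, D'e]
      have := hx_gen (c := 1) (fZb p q ht) (fDa q p ht.symm) (Cb _ q (ax p))
        (Commute.one_left _) (Commute.one_left _) (by rw [one_mul]; exact hZD _ _ hl)
      rwa [one_mul] at this
  · intro p q hpq
    rcases key q p hpq with ⟨rfl, rfl⟩ | ⟨hl, ht⟩
    · have e := hZD _ _ hlt
      rw [h'e, h'e, Z'e, D'e, aj, bi, si, sj, ← hx]
      have Zq : Z q * Ring.inverse x = Ring.inverse (x - 1) * Z q := Ziy
      have L : Ring.inverse (x - 1) * Z q * (-(Ring.inverse x) * D p)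
          = -(Ring.inverse (x - 1) ^ 2 * (D p * Z q)) := by
        calc _ = -(Ring.inverse (x - 1) * (Z q * Ring.inverse x) * D p) := by noncomm_ring
          _ = -(Ring.inverse (x - 1) ^ 2 * (Z q * D p)) := by rw [Zq]; noncomm_ring
          _ = _ := by rw [e]
      have R : -(Ring.inverse x) * D p * (Ring.inverse (x - 1) * Z q)
          = -(Ring.inverse x * Ring.inverse (x - 2) * (D p * Z q)) := by
        calc _ = -(Ring.inverse x * (D p * Ring.inverse (x - 1)) * Z q) := by noncomm_ring
          _ = _ := by rw [Djxmy]; noncomm_ring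
      rw [L, R]
      have c0 : Commute x (x - 1) := (Commute.refl x).sub_right (Commute.one_right x)
      have c0' : Commute x (x - 2) := (Commute.refl x).sub_right (Commute.ofNat_right x 2)
      have w0 : Commute x (Ring.inverse (x - 1) ^ 2) := (hx_comm_inv c0).pow_right 2
      have w1 : Commute (Ring.inverse (x - 1) ^ 2) (Ring.inverse x) := hx_comm_inv w0.symm
      have w2 : Commute (Ring.inverse (x - 1) ^ 2) (Ring.inverse (x - 2)) :=
        hx_comm_inv (w0.symm.sub_right (Commute.ofNat_right _ 2))
      have w3 : Commute (x - 2) (Ring.inverse x) := hx_comm_inv c0'.symm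
      have E : x * (x - 2) * Ring.inverse (x - 1) ^ 2 * (Ring.inverse x * Ring.inverse (x - 2))
          = Ring.inverse (x - 1) ^ 2 := by
        rw [mul_assoc, (w1.mul_right w2).eq, ← mul_assoc]
        have : x * (x - 2) * (Ring.inverse x * Ring.inverse (x - 2)) = 1 := by
          calc _ = x * ((x - 2) * Ring.inverse x) * Ring.inverse (x - 2) := by
                simp only [mul_assoc]
            _ = (x * Ring.inverse x) * ((x - 2) * Ring.inverse (x - 2)) := by
                rw [w3.eq]; simp only [mul_assoc]
            _ = 1 := by rw [ix, imx2, one_mul]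
        rw [this, one_mul]
      rw [mul_neg, ← mul_assoc _ _ (D p * Z q), E]
    · rw [h'e, h'e, Z'e, D'e]
      have cx : Commute ((h (s p) - h (s q)) * (h (s p) - h (s q) - 2) *
          (Ring.inverse (h (s p) - h (s q) - 1)) ^ 2) x :=
        (((dx _ _).mul_right ((dx _ _).sub_right (Commute.ofNat_right _ 2))).mul_right
          ((hx_comm_inv ((dx _ _).sub_right (Commute.one_right _))).pow_right 2)).symm
      exact hx_gen (fZb p q ht.symm) (fDa q p ht) (Cb _ _ (ax _)) (Ca _ _ cx) (Cb _ _ cx)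
        (hZD' _ _ hl)
  · intro p
    rw [ZD, hZDdiag]
    congr 1
    rw [← Equiv.sum_comp s]
    refine Finset.sum_congr rfl fun q _ => ?_
    rw [DZ, h'e, h'e]
end

section
/- Fix i ∈ {1, …, n−1} and define new elements by the substitution s_i: h̃'_j = h̃_{s_i(j)} where s_i is the transposition (i, i+1); Z'^{i,α} = −Z^{i+1,α} h̃_{i,i+1}, Z'^{i+1,α} = Z^{i,α} h̃_{i,i+1}^{−1}, Z'^{j,α} = Z^{j,α} for j ≠ i, i+1; ∂'_{i,α} = −h̃_{i,i+1}^{−1} ∂_{i+1,α}, ∂'_{i+1,α} = h̃_{i,i+1} ∂_{i,α}, ∂'_{j,α} = ∂_{j,α} for j ≠ i, i+1 (α = 1, …, N). Then the elements h̃'_j, Z'^{j,α}, ∂'_{j,α} satisfy all the defining relations of Diff_h(n, N) listed in the context; that is, s_i acts by an endomorphism respecting the relations of the ring Diff_h(n, N). -/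
open Finset

namespace DiffH

variable {A : Type*} [Ring A]

theorem inv_eq {a b : A} (h1 : a * b = 1) (h2 : b * a = 1) : Ring.inverse a = b :=
  Ring.inverse_unit ⟨a, b, h1, h2⟩

theorem comm_inv {a x : A} (hx : Commute a x) : Commute a (Ring.inverse x) := by
  by_cases hu : IsUnit x
  · obtain ⟨u, rfl⟩ := hu
    rw [Ring.inverse_unit]
    exact hx.units_inv_right
  · rw [Ring.inverse_non_unit _ hu]
    exact Commute.zero_right a

theorem semi_inv {a x y u v : A} (hx : x * u = 1) (hy : v * y = 1)
    (hs : a * x = y * a) : a * u = v * a := by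
  calc a * u = v * y * a * u := by rw [hy, one_mul]
    _ = v * (a * x) * u := by rw [hs]; noncomm_ring
    _ = v * a * (x * u) := by noncomm_ring
    _ = v * a := by rw [hx, mul_one]

theorem inv_comm {x y u v : A} (hx : x * u = 1) (hx' : u * x = 1) (hy : y * v = 1)
    (hy' : v * y = 1) (hc : x * y = y * x) : u * v = v * u := by
  have h1 : x * v = v * x := semi_inv hy hy' hc
  exact (semi_inv hx hx' h1.symm).symm

/- moving generic coefficients -/
theorem genZ {P Q c e : A} (h1 : Commute c Q) (h3 : Commute c e) :
    P * c * (Q * e) = P * Q * (e * c) := by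
  rw [← h3.eq]
  calc P * c * (Q * e) = P * (c * Q) * e := by noncomm_ring
    _ = _ := by rw [h1.eq]; noncomm_ring

theorem genD {P Q c e : A} (h1 : Commute e P) :
    c * P * (e * Q) = c * e * (P * Q) := by
  calc c * P * (e * Q) = c * (P * e) * Q := by noncomm_ring
    _ = _ := by rw [← h1.eq]; noncomm_ring

/-- coefficient identity -/
theorem coef1 {H U V : A} (hU : H * U = 1) (hU' : U * H = 1) (hV : (H - 1) * V = 1)
    (hV' : V * (H - 1) = 1) : (H ^ 2 - 1) * U ^ 2 * (V * H) = (H + 1) * U := by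
  have e1 : U * V = V * U := inv_comm hU hU' hV hV' (by noncomm_ring)
  have e2 : (H - 1) * U = U * (H - 1) := by rw [sub_mul, mul_sub, hU, hU']; simp
  calc (H ^ 2 - 1) * U ^ 2 * (V * H) = (H + 1) * ((H - 1) * U) * (U * V) * H := by noncomm_ring
    _ = (H + 1) * U * ((H - 1) * V) * (U * H) := by rw [e1, e2]; noncomm_ring
    _ = _ := by rw [hV, hU']; simp

theorem coef2 {H U W : A} (hU : H * U = 1) (hU' : U * H = 1) (hV : (H + 1) * W = 1)
    (hV' : W * (H + 1) = 1) : (H ^ 2 - 1) * U ^ 2 * (H * W) = U * (H - 1) := by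
  have e1 : U * W = W * U := inv_comm hU hU' hV hV' (by noncomm_ring)
  have e2 : (H - 1) * U = U * (H - 1) := by rw [sub_mul, mul_sub, hU, hU']; simp
  have e3 : (H + 1) * U = U * (H + 1) := by rw [add_mul, mul_add, hU, hU']; simp
  calc (H ^ 2 - 1) * U ^ 2 * (H * W) = (H - 1) * ((H + 1) * U) * (U * H) * W := by noncomm_ring
    _ = ((H - 1) * U) * ((H + 1) * W) := by rw [e3, hU']; noncomm_ring
    _ = _ := by rw [hV, e2]; simp

theorem ijZa {H U Zi Zj : A} (hU : H * U = 1) (hU' : U * H = 1)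
    (hi : Zi * H = (H - 1) * Zi) (hj : Zj * H = (H + 1) * Zj) :
    -(Zj * H) * (Zi * U) = -((H + 1) * U * (Zj * Zi)) := by
  have h0 : (Zj * Zi) * H = H * (Zj * Zi) := by
    rw [mul_assoc, hi, ← mul_assoc, mul_sub, hj]; noncomm_ring
  have h1 := semi_inv hU hU' h0
  calc -(Zj * H) * (Zi * U) = -((H + 1) * (Zj * Zi * U)) := by rw [hj]; noncomm_ring
    _ = _ := by rw [h1]; noncomm_ring

theorem ijZb {H U V Zi Zj : A} (hU : H * U = 1) (hV' : V * (H - 1) = 1)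
    (hi : Zi * H = (H - 1) * Zi) (hj : Zj * H = (H + 1) * Zj) :
    (Zi * U) * -(Zj * H) = -(V * H * (Zi * Zj)) := by
  have h0 : (Zi * Zj) * H = H * (Zi * Zj) := by
    rw [mul_assoc, hj, ← mul_assoc, mul_add, hi]; noncomm_ring
  have h1 : Zi * U = V * Zi := semi_inv hU hV' hi
  calc (Zi * U) * -(Zj * H) = -(V * (Zi * Zj * H)) := by rw [h1]; noncomm_ring
    _ = _ := by rw [h0]; noncomm_ring

theorem ijDa {H U Di Dj : A} (hj : Dj * H = (H - 1) * Dj) :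
    -(U * Dj) * (H * Di) = -(U * (H - 1) * (Dj * Di)) := by
  calc -(U * Dj) * (H * Di) = -(U * (Dj * H) * Di) := by noncomm_ring
    _ = _ := by rw [hj]; noncomm_ring

theorem ijDb {H U W Di Dj : A} (hU : H * U = 1) (hW' : W * (H + 1) = 1)
    (hi : Di * H = (H + 1) * Di) :
    (H * Di) * -(U * Dj) = -(H * W * (Di * Dj)) := by
  have h1 : Di * U = W * Di := semi_inv hU hW' hi
  calc (H * Di) * -(U * Dj) = -(H * (Di * U) * Dj) := by noncomm_ring
    _ = _ := by rw [h1]; noncomm_ring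

/-- a b c d: `a = ZiαZjβ`, `b = ZiβZjα`, `c = ZjαZiβ`, `d = ZjβZiα`. -/
theorem ijZZ1 {H U V b c d : A} (hU : H * U = 1) (hU' : U * H = 1) (hV : (H - 1) * V = 1)
    (hV' : V * (H - 1) = 1) (h2 : c = -U * d + b) :
    -((H + 1) * U * c) = -U * -((H + 1) * U * d) + ((-H) ^ 2 - 1) * (-U) ^ 2 * -(V * H * b) := by
  have k := coef1 hU hU' hV hV'
  have e3 : (H + 1) * U = U * (H + 1) := by rw [add_mul, mul_add, hU, hU']; simp
  have : ((-H) ^ 2 - 1) * (-U) ^ 2 * -(V * H * b) = -((H + 1) * U * b) := by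
    rw [← k]; noncomm_ring
  rw [this, h2]
  have e4 : -U * -((H + 1) * U * d) = (H + 1) * U * (U * d) := by
    calc -U * -((H + 1) * U * d) = (U * (H + 1)) * (U * d) := by noncomm_ring
      _ = _ := by rw [← e3]
  rw [e4]; noncomm_ring

theorem ijZZ2 {H U V a b d : A} (hU : H * U = 1) (hU' : U * H = 1) (hV : (H - 1) * V = 1)
    (hV' : V * (H - 1) = 1) (h1 : a = U * b + (H ^ 2 - 1) * U ^ 2 * d) :
    -(V * H * a) = - -U * -(V * H * b) + -((H + 1) * U * d) := by
  have k := coef1 hU hU' hV hV'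
  have e1 : U * V = V * U := inv_comm hU hU' hV hV' (by noncomm_ring)
  have e3 : V * H = H * V := (semi_inv (a := H) hV hV' (by noncomm_ring)).symm
  have e4 : V * H * ((H ^ 2 - 1) * U ^ 2) = (H + 1) * U := by
    have c1 : Commute H U := by rw [commute_iff_eq, hU, hU']
    have c2 : Commute V H := e3
    have c3 : Commute V U := e1.symm
    have : Commute (V * H) ((H ^ 2 - 1) * U ^ 2) :=
      Commute.mul_left
        (((c2.pow_right 2).sub_right (Commute.one_right _)).mul_right (c3.pow_right 2))
        ((((Commute.refl H).pow_right 2).sub_right (Commute.one_right _)).mul_right (c1.pow_right 2))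
    rw [this.eq, k]
  have e5 : V * H * U = U * (V * H) := by
    rw [mul_assoc, hU, ← mul_assoc, e1, mul_assoc, hU']
  calc -(V * H * a) = -((V * H * U) * b) - V * H * ((H ^ 2 - 1) * U ^ 2) * d := by
        rw [h1]; noncomm_ring
    _ = _ := by rw [e4, e5]; noncomm_ring

theorem ijDD1 {H U W b c d : A} (hU : H * U = 1) (hU' : U * H = 1) (hW : (H + 1) * W = 1)
    (hW' : W * (H + 1) = 1) (h2 : c = U * d + b) :
    -(U * (H - 1) * c) = - -U * -(U * (H - 1) * d) +
      ((-H) ^ 2 - 1) * (-U) ^ 2 * -(H * W * b) := by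
  have k := coef2 hU hU' hW hW'
  have e3 : (H - 1) * U = U * (H - 1) := by rw [sub_mul, mul_sub, hU, hU']; simp
  have : ((-H) ^ 2 - 1) * (-U) ^ 2 * -(H * W * b) = -(U * (H - 1) * b) := by
    rw [← k]; noncomm_ring
  rw [this, h2]
  have e4 : U * (H - 1) * (U * d) = U * (U * (H - 1) * d) := by
    calc U * (H - 1) * (U * d) = U * ((H - 1) * U) * d := by noncomm_ring
      _ = _ := by rw [e3]; noncomm_ring
  rw [mul_add, e4]; noncomm_ring

theorem ijDD2 {H U W a b d : A} (hU : H * U = 1) (hU' : U * H = 1) (hW : (H + 1) * W = 1)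
    (hW' : W * (H + 1) = 1) (h1 : a = -U * b + (H ^ 2 - 1) * U ^ 2 * d) :
    -(H * W * a) = -U * -(H * W * b) + -(U * (H - 1) * d) := by
  have k := coef2 hU hU' hW hW'
  have e1 : U * W = W * U := inv_comm hU hU' hW hW' (by noncomm_ring)
  have e3 : W * H = H * W := (semi_inv (a := H) hW hW' (by noncomm_ring)).symm
  have e4 : H * W * ((H ^ 2 - 1) * U ^ 2) = U * (H - 1) := by
    have c1 : Commute H U := by rw [commute_iff_eq, hU, hU']
    have c2 : Commute W H := e3
    have c3 : Commute W U := e1.symm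
    have : Commute (H * W) ((H ^ 2 - 1) * U ^ 2) :=
      Commute.mul_left
        ((((Commute.refl H).pow_right 2).sub_right (Commute.one_right _)).mul_right (c1.pow_right 2))
        (((c2.pow_right 2).sub_right (Commute.one_right _)).mul_right (c3.pow_right 2))
    rw [this.eq, k]
  have e5 : H * W * U = U * (H * W) := by
    rw [mul_assoc, ← e1, ← mul_assoc, ← mul_assoc, hU, hU']
  calc -(H * W * a) = ((H * W * U) * b) - H * W * ((H ^ 2 - 1) * U ^ 2) * d := by
        rw [h1]; noncomm_ring
    _ = _ := by rw [e4, e5]; noncomm_ring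

theorem ijZD1 {H W Zj Di : A} (hW : (H + 1) * W = 1)
    (hi : Di * H = (H + 1) * Di) (hj : Zj * H = (H + 1) * Zj)
    (h2 : Zj * Di = H * (H + 2) * W ^ 2 * (Di * Zj)) :
    -(Zj * H) * (H * Di) = (H * Di) * -(Zj * H) := by
  have l : Zj * H * H * Di = H * (H + 2) * (Di * Zj) := by
    calc Zj * H * H * Di = (Zj * H) * H * Di := rfl
      _ = (H + 1) * (Zj * H) * Di := by rw [hj, mul_assoc (H + 1) Zj H, hj]
      _ = (H + 1) * (H + 1) * (Zj * Di) := by rw [hj]; noncomm_ring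
      _ = H * (H + 2) * ((H + 1) * ((H + 1) * W) * W) * (Di * Zj) := by rw [h2]; noncomm_ring
      _ = _ := by rw [hW, mul_one, hW]; noncomm_ring
  have r : Di * Zj * H = (H + 2) * (Di * Zj) := by
    calc Di * Zj * H = Di * (Zj * H) := by noncomm_ring
      _ = Di * H * Zj + Di * Zj := by rw [hj]; noncomm_ring
      _ = _ := by rw [hi]; noncomm_ring
  calc -(Zj * H) * (H * Di) = -(Zj * H * H * Di) := by noncomm_ring
    _ = -(H * ((H + 2) * (Di * Zj))) := by rw [l]; noncomm_ring
    _ = _ := by rw [← r]; noncomm_ring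

theorem ijZD2 {H U V X Zi Dj : A} (hU : H * U = 1) (hU' : U * H = 1) (hV : (H - 1) * V = 1)
    (hV' : V * (H - 1) = 1) (hX : (H - 2) * X = 1) (hX' : X * (H - 2) = 1)
    (hi : Zi * H = (H - 1) * Zi) (hj : Dj * H = (H - 1) * Dj)
    (h1 : Zi * Dj = Dj * Zi) :
    (Zi * U) * -(U * Dj) = (-H) * (-H + 2) * (-V) ^ 2 * (-(U * Dj) * (Zi * U)) := by
  have a1 : Zi * U = V * Zi := semi_inv hU hV' hi
  have a2 : V * U = U * V := (inv_comm hU hU' hV hV' (by noncomm_ring)).symm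
  have r : Dj * Zi * H = (H - 2) * (Dj * Zi) := by
    calc Dj * Zi * H = Dj * (Zi * H) := by noncomm_ring
      _ = Dj * H * Zi - Dj * Zi := by rw [hi]; noncomm_ring
      _ = _ := by rw [hj]; noncomm_ring
  have r2 : Dj * Zi * U = X * (Dj * Zi) := semi_inv hU hX' r
  have a3 : V * U = U * V := a2
  have a5 : X * U = U * X := inv_comm hX hX' hU hU' (by noncomm_ring)
  have a6 : H * V = V * H := semi_inv hV hV' (by noncomm_ring)
  have a8 : Commute (V ^ 2) H := (show Commute V H from a6.symm).pow_left 2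
  have a7 : Commute (V ^ 2) (H * (H - 2)) :=
    a8.mul_right (a8.sub_right (Nat.cast_commute 2 (V ^ 2)).symm)
  calc (Zi * U) * -(U * Dj) = -(V * (Zi * U) * Dj) := by rw [a1]; simp only [mul_neg]; rw [← mul_assoc, mul_assoc V Zi U, a1]
    _ = -(V ^ 2 * (Dj * Zi)) := by rw [a1, ← h1]; noncomm_ring
    _ = -(V ^ 2 * (H * ((H - 2) * X) * U) * (Dj * Zi)) := by rw [hX, mul_one, hU]; noncomm_ring
    _ = -(V ^ 2 * (H * (H - 2)) * (U * X) * (Dj * Zi)) := by rw [← a5]; noncomm_ring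
    _ = -(H * (H - 2) * V ^ 2 * (U * X) * (Dj * Zi)) := by rw [a7.eq]
    _ = -(H * (H - 2) * V ^ 2 * U * (X * (Dj * Zi))) := by noncomm_ring
    _ = _ := by rw [← r2]; noncomm_ring

theorem move {P Q c e : A} (h1 : Commute e P) (h2 : Commute c Q) (h3 : Commute c e) :
    P * c * (e * Q) = e * (P * Q) * c := by
  calc P * c * (e * Q) = P * (c * e) * Q := by noncomm_ring
    _ = (P * e) * (c * Q) := by rw [h3.eq]; noncomm_ring
    _ = _ := by rw [← h1.eq, h2.eq]; noncomm_ring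

end DiffH



/-- Lemma 5.2 of Herlemont–Ogievetsky: the substitution `s_i` (with `s_i` the transposition
`(i, i+1)` on the index set), given by `Z^{i,α} ↦ −Z^{i+1,α} h̃_{i,i+1}`,
`Z^{i+1,α} ↦ Z^{i,α} h̃_{i,i+1}⁻¹`, `∂_{i,α} ↦ −h̃_{i,i+1}⁻¹ ∂_{i+1,α}`,
`∂_{i+1,α} ↦ h̃_{i,i+1} ∂_{i,α}` (fixing all other generators) and `h̃_j ↦ h̃_{s_i(j)}`,
respects all the defining relations of the ring `Diff_h(n, N)` of h-deformed differential
operators. -/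
theorem stmt14 {k A : Type*} [Field k] [CharZero k] [Ring A] [Algebra k A]
    {n N : ℕ} (hn : 1 ≤ n) (hN : 1 ≤ N)
    (h : Fin n → A) (Z D : Fin n → Fin N → A)
    (hcomm : ∀ i j, h i * h j = h j * h i)
    (hunit : ∀ (i j : Fin n) (m : ℤ), i ≠ j → IsUnit (h i - h j + (m : A)))
    (hhZ : ∀ i j α, h i * Z j α = Z j α * (h i + if i = j then 1 else 0))
    (hhD : ∀ i j α, h i * D j α = D j α * (h i - if i = j then 1 else 0))
    (hZZ1 : ∀ i j α β, i < j → Z i α * Z j β =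
      Ring.inverse (h i - h j) * (Z i β * Z j α) +
      ((h i - h j) ^ 2 - 1) * (Ring.inverse (h i - h j)) ^ 2 * (Z j β * Z i α))
    (hZZ2 : ∀ i j α β, i < j → Z j α * Z i β =
      -Ring.inverse (h i - h j) * (Z j β * Z i α) + Z i β * Z j α)
    (hDD1 : ∀ i j α β, i < j → D i α * D j β =
      -Ring.inverse (h i - h j) * (D i β * D j α) +
      ((h i - h j) ^ 2 - 1) * (Ring.inverse (h i - h j)) ^ 2 * (D j β * D i α))
    (hDD2 : ∀ i j α β, i < j → D j α * D i β =
      Ring.inverse (h i - h j) * (D j β * D i α) + D i β * D j α)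
    (hZD1 : ∀ i j α β, i < j → Z i α * D j β = D j β * Z i α)
    (hZD2 : ∀ i j α β, i < j → Z j α * D i β =
      (h i - h j) * ((h i - h j) + 2) * (Ring.inverse ((h i - h j) + 1)) ^ 2 * (D i β * Z j α))
    (hZDdiag : ∀ i α β, Z i α * D i β =
      (∑ m, Ring.inverse (1 - (h i - h m)) * (D m β * Z m α)) -
        if α = β then 1 else 0)
    (i j : Fin n) (hij : (i : ℕ) + 1 = (j : ℕ)) :
    ∀ (h' : Fin n → A) (Z' D' : Fin n → Fin N → A),
      h' = (fun m => h (Equiv.swap i j m)) →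
      Z' = (fun m α => if m = i then -(Z j α * (h i - h j))
            else if m = j then Z i α * Ring.inverse (h i - h j) else Z m α) →
      D' = (fun m α => if m = i then -(Ring.inverse (h i - h j) * D j α)
            else if m = j then (h i - h j) * D i α else D m α) →
      ((∀ p q α, h' p * Z' q α = Z' q α * (h' p + if p = q then 1 else 0)) ∧
      (∀ p q α, h' p * D' q α = D' q α * (h' p - if p = q then 1 else 0)) ∧
      (∀ p q α β, p < q → Z' p α * Z' q β =
        Ring.inverse (h' p - h' q) * (Z' p β * Z' q α) +
        ((h' p - h' q) ^ 2 - 1) * (Ring.inverse (h' p - h' q)) ^ 2 * (Z' q β * Z' p α)) ∧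
      (∀ p q α β, p < q → Z' q α * Z' p β =
        -Ring.inverse (h' p - h' q) * (Z' q β * Z' p α) + Z' p β * Z' q α) ∧
      (∀ p q α β, p < q → D' p α * D' q β =
        -Ring.inverse (h' p - h' q) * (D' p β * D' q α) +
        ((h' p - h' q) ^ 2 - 1) * (Ring.inverse (h' p - h' q)) ^ 2 * (D' q β * D' p α)) ∧
      (∀ p q α β, p < q → D' q α * D' p β =
        Ring.inverse (h' p - h' q) * (D' q β * D' p α) + D' p β * D' q α) ∧
      (∀ p q α β, p < q → Z' p α * D' q β = D' q β * Z' p α) ∧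
      (∀ p q α β, p < q → Z' q α * D' p β =
        (h' p - h' q) * ((h' p - h' q) + 2) * (Ring.inverse ((h' p - h' q) + 1)) ^ 2 *
          (D' p β * Z' q α)) ∧
      (∀ p α β, Z' p α * D' p β =
        (∑ m, Ring.inverse (1 - (h' p - h' m)) * (D' m β * Z' m α)) -
          if α = β then 1 else 0)) := by
  intro h' Z' D' hh' hZ' hD'
  have hne : i ≠ j := by
    intro e; rw [e] at hij; omega
  obtain ⟨H, hH⟩ : ∃ H, H = h i - h j := ⟨_, rfl⟩
  obtain ⟨U, hUd⟩ : ∃ U, U = Ring.inverse H := ⟨_, rfl⟩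
  have unitm : ∀ m : ℤ, IsUnit (H + (m : A)) := fun m => by rw [hH]; exact hunit i j m hne
  have uH : IsUnit H := by simpa using unitm 0
  have uV : IsUnit (H - 1) := by simpa [sub_eq_add_neg] using unitm (-1)
  have uW : IsUnit (H + 1) := by simpa using unitm 1
  have uX : IsUnit (H - 2) := by simpa [sub_eq_add_neg] using unitm (-2)
  have hU : H * U = 1 := by rw [hUd]; exact Ring.mul_inverse_cancel _ uH
  have hU' : U * H = 1 := by rw [hUd]; exact Ring.inverse_mul_cancel _ uH
  obtain ⟨V, hV, hV'⟩ : ∃ V, (H - 1) * V = 1 ∧ V * (H - 1) = 1 :=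
    ⟨_, Ring.mul_inverse_cancel _ uV, Ring.inverse_mul_cancel _ uV⟩
  obtain ⟨W, hW, hW'⟩ : ∃ W, (H + 1) * W = 1 ∧ W * (H + 1) = 1 :=
    ⟨_, Ring.mul_inverse_cancel _ uW, Ring.inverse_mul_cancel _ uW⟩
  obtain ⟨X, hX, hX'⟩ : ∃ X, (H - 2) * X = 1 ∧ X * (H - 2) = 1 :=
    ⟨_, Ring.mul_inverse_cancel _ uX, Ring.inverse_mul_cancel _ uX⟩
  rw [← hH] at hZ' hD'
  rw [← hUd] at hZ' hD'
  -- commutation with the generators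
  have ZiH : ∀ α, Z i α * H = (H - 1) * Z i α := by
    intro α
    have e1 := hhZ i i α
    have e2 := hhZ j i α
    rw [if_pos rfl] at e1
    rw [if_neg hne.symm] at e2
    rw [hH, sub_mul, sub_mul, e1, e2]; noncomm_ring
  have ZjH : ∀ α, Z j α * H = (H + 1) * Z j α := by
    intro α
    have e1 := hhZ i j α
    have e2 := hhZ j j α
    rw [if_neg hne] at e1
    rw [if_pos rfl] at e2
    rw [hH, add_mul, sub_mul, e1, e2]; noncomm_ring
  have DiH : ∀ α, D i α * H = (H + 1) * D i α := by
    intro α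
    have e1 := hhD i i α
    have e2 := hhD j i α
    rw [if_pos rfl] at e1
    rw [if_neg hne.symm] at e2
    rw [hH, add_mul, sub_mul, e1, e2]; noncomm_ring
  have DjH : ∀ α, D j α * H = (H - 1) * D j α := by
    intro α
    have e1 := hhD i j α
    have e2 := hhD j j α
    rw [if_neg hne] at e1
    rw [if_pos rfl] at e2
    rw [hH, sub_mul, sub_mul, e1, e2]; noncomm_ring
  have HZ : ∀ m α, m ≠ i → m ≠ j → Commute H (Z m α) := by
    intro m α h1 h2
    have e1 := hhZ i m α
    have e2 := hhZ j m α
    rw [if_neg h1.symm] at e1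
    rw [if_neg h2.symm] at e2
    rw [commute_iff_eq, hH, sub_mul, e1, e2]; noncomm_ring
  have HD : ∀ m α, m ≠ i → m ≠ j → Commute H (D m α) := by
    intro m α h1 h2
    have e1 := hhD i m α
    have e2 := hhD j m α
    rw [if_neg h1.symm] at e1
    rw [if_neg h2.symm] at e2
    rw [commute_iff_eq, hH, sub_mul, e1, e2]; noncomm_ring
  have Hh : ∀ m, Commute H (h m) := by
    intro m
    rw [hH]
    exact (show Commute (h i) (h m) from hcomm i m).sub_left (hcomm j m)
  have HDZ : ∀ m α β, Commute H (D m β * Z m α) := by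
    intro m α β
    rw [hH]
    have : ∀ l, Commute (h l) (D m β * Z m α) := by
      intro l
      have e1 := hhZ l m α
      have e2 := hhD l m β
      rw [commute_iff_eq, ← mul_assoc, e2, mul_assoc, sub_mul, e1]
      split_ifs <;> noncomm_ring
    exact (this i).sub_left (this j)
  have toU : ∀ x, Commute H x → Commute U x := by
    intro x hx
    rw [hUd]; exact (DiffH.comm_inv hx.symm).symm
  -- uniform description
  obtain ⟨c, hc⟩ : ∃ c : Fin n → A, c = fun m => if m = i then -H else if m = j then U else 1 :=
    ⟨_, rfl⟩
  obtain ⟨d, hd⟩ : ∃ d : Fin n → A, d = fun m => if m = i then -U else if m = j then H else 1 :=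
    ⟨_, rfl⟩
  obtain ⟨σ, hσ⟩ : ∃ σ : Equiv.Perm (Fin n), σ = Equiv.swap i j := ⟨_, rfl⟩
  have σi : σ i = j := by rw [hσ]; exact Equiv.swap_apply_left i j
  have σj : σ j = i := by rw [hσ]; exact Equiv.swap_apply_right i j
  have σo : ∀ m, m ≠ i → m ≠ j → σ m = m := fun m h1 h2 => by
    rw [hσ]; exact Equiv.swap_apply_of_ne_of_ne h1 h2
  have h'e : ∀ m, h' m = h (σ m) := fun m => by rw [hh', hσ]
  have Z'e : ∀ m α, Z' m α = Z (σ m) α * c m := by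
    intro m α
    rw [hZ', hc]
    by_cases h1 : m = i
    · subst h1; simp [σi]
    · by_cases h2 : m = j
      · subst h2; simp [σj, h1]
      · simp [h1, h2, σo m h1 h2]
  have D'e : ∀ m α, D' m α = d m * D (σ m) α := by
    intro m α
    rw [hD', hd]
    by_cases h1 : m = i
    · subst h1; simp [σi]
    · by_cases h2 : m = j
      · subst h2; simp [σj, h1]
      · simp [h1, h2, σo m h1 h2]
  have cX : ∀ m x, Commute H x → Commute (c m) x := by
    intro m x hx
    rw [hc]; dsimp only
    split_ifs
    · exact hx.neg_left
    · exact toU x hx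
    · exact Commute.one_left x
  have dX : ∀ m x, Commute H x → Commute (d m) x := by
    intro m x hx
    rw [hd]; dsimp only
    split_ifs
    · exact (toU x hx).neg_left
    · exact hx
    · exact Commute.one_left x
  have cd : ∀ m, c m * d m = 1 := by
    intro m
    rw [hc, hd]; dsimp only
    split_ifs <;> simp [hU, hU']
  have dc : ∀ m, d m * c m = 1 := by
    intro m
    rw [hc, hd]; dsimp only
    split_ifs <;> simp [hU, hU']
  have c1 : ∀ m, m ≠ i → m ≠ j → c m = 1 := by
    intro m h1 h2; rw [hc]; simp [h1, h2]
  have d1 : ∀ m, m ≠ i → m ≠ j → d m = 1 := by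
    intro m h1 h2; rw [hd]; simp [h1, h2]
  have Hc : ∀ m, Commute H (c m) := fun m => (cX m H (Commute.refl H)).symm
  have Hd : ∀ m, Commute H (d m) := fun m => (dX m H (Commute.refl H)).symm
  -- pairs other than (i, j)
  have key : ∀ p q, p < q → (p = i ∧ q = j) ∨
      (σ p < σ q ∧ (∀ α, Commute (c p) (Z (σ q) α)) ∧ (∀ α, Commute (c q) (Z (σ p) α)) ∧
        (∀ α, Commute (c p) (D (σ q) α)) ∧ (∀ α, Commute (c q) (D (σ p) α)) ∧
        (∀ α, Commute (d p) (Z (σ q) α)) ∧ (∀ α, Commute (d q) (Z (σ p) α)) ∧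
        (∀ α, Commute (d p) (D (σ q) α)) ∧ (∀ α, Commute (d q) (D (σ p) α))) := by
    intro p q hpq
    by_cases hq : q ≠ i ∧ q ≠ j
    · right
      rw [σo q hq.1 hq.2, c1 q hq.1 hq.2, d1 q hq.1 hq.2]
      refine ⟨?_, fun α => cX p _ (HZ q α hq.1 hq.2), fun α => Commute.one_left _,
        fun α => cX p _ (HD q α hq.1 hq.2), fun α => Commute.one_left _,
        fun α => dX p _ (HZ q α hq.1 hq.2), fun α => Commute.one_left _,
        fun α => dX p _ (HD q α hq.1 hq.2), fun α => Commute.one_left _⟩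
      by_cases h1 : p = i
      · rw [h1, σi]; rw [h1] at hpq
        have := hq.2
        rw [Fin.lt_def] at *; rw [Ne, Fin.ext_iff] at this; omega
      · by_cases h2 : p = j
        · rw [h2, σj]; rw [h2] at hpq
          rw [Fin.lt_def] at *; omega
        · rwa [σo p h1 h2]
    · by_cases hp : p ≠ i ∧ p ≠ j
      · right
        rw [σo p hp.1 hp.2, c1 p hp.1 hp.2, d1 p hp.1 hp.2]
        refine ⟨?_, fun α => Commute.one_left _, fun α => cX q _ (HZ p α hp.1 hp.2),
          fun α => Commute.one_left _, fun α => cX q _ (HD p α hp.1 hp.2),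
          fun α => Commute.one_left _, fun α => dX q _ (HZ p α hp.1 hp.2),
          fun α => Commute.one_left _, fun α => dX q _ (HD p α hp.1 hp.2)⟩
        by_cases h1 : q = i
        · rw [h1, σi]; rw [h1] at hpq
          rw [Fin.lt_def] at *; omega
        · have h2 : q = j := by tauto
          rw [h2, σj]; rw [h2] at hpq
          have := hp.1
          rw [Fin.lt_def] at *; rw [Ne, Fin.ext_iff] at this; omega
      · left
        rw [Fin.lt_def] at hpq
        have a1 : p = i ∨ p = j := by tauto
        have a2 : q = i ∨ q = j := by tauto
        rcases a1 with rfl | rfl <;> rcases a2 with rfl | rfl <;> first | omega | exact ⟨rfl, rfl⟩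
  have hijlt : i < j := by rw [Fin.lt_def]; omega
  have hneg : h' i - h' j = -H := by rw [h'e, h'e, σi, σj, hH]; noncomm_ring
  have invneg : Ring.inverse (-H) = -U := DiffH.inv_eq (by simpa using hU) (by simpa using hU')
  have invneg1 : Ring.inverse (-H + 1) = -V := DiffH.inv_eq
    (Eq.trans (by noncomm_ring) hV) (Eq.trans (by noncomm_ring) hV')
  have Hdiff : ∀ p q, Commute H (h p - h q) := fun p q => (Hh p).sub_right (Hh q)
  have Z'i : ∀ α, Z' i α = -(Z j α * H) := fun α => by rw [hZ']; simp
  have Z'j : ∀ α, Z' j α = Z i α * U := fun α => by rw [hZ']; simp [hne.symm]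
  have D'i : ∀ α, D' i α = -(U * D j α) := fun α => by rw [hD']; simp
  have D'j : ∀ α, D' j α = H * D i α := fun α => by rw [hD']; simp [hne.symm]
  refine ⟨?_, ?_, ?_, ?_, ?_, ?_, ?_, ?_, ?_⟩
  · intro p q α
    rw [h'e, Z'e, ← mul_assoc, hhZ, mul_assoc, mul_assoc]
    have e : (if σ p = σ q then (1 : A) else 0) = if p = q then 1 else 0 := by
      simp [σ.injective.eq_iff]
    have e2 : Commute (c q) (if p = q then (1 : A) else 0) := by
      split_ifs <;> simp
    rw [e, ((cX q _ (Hh (σ p))).add_right e2).eq]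
  · intro p q α
    have e : (if σ p = σ q then (1 : A) else 0) = if p = q then 1 else 0 := by
      simp [σ.injective.eq_iff]
    rw [h'e, D'e, ← mul_assoc, ← (dX q _ (Hh (σ p))).eq, mul_assoc, hhD, e, mul_assoc]
  · intro p q α β hpq
    rcases key p q hpq with ⟨rfl, rfl⟩ | ⟨hs, z1, z2, -⟩
    · rw [hneg, invneg]
      simp only [Z'i, Z'j]
      rw [DiffH.ijZa hU hU' (ZiH _) (ZjH _), DiffH.ijZa hU hU' (ZiH _) (ZjH _),
        DiffH.ijZb hU hV' (ZiH _) (ZjH _)]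
      refine DiffH.ijZZ1 hU hU' hV hV' ?_
      rw [hUd, hH]; exact hZZ2 _ _ _ _ hijlt
    · have cc : Commute (c p) (c q) := cX p _ (Hc q)
      simp only [Z'e, h'e]
      rw [DiffH.genZ (z1 _) cc, DiffH.genZ (z1 _) cc, DiffH.genZ (z2 _) cc.symm, cc.eq,
        hZZ1 _ _ α β hs]
      noncomm_ring
  · intro p q α β hpq
    rcases key p q hpq with ⟨rfl, rfl⟩ | ⟨hs, z1, z2, -⟩
    · rw [hneg, invneg]
      simp only [Z'i, Z'j]
      rw [DiffH.ijZa hU hU' (ZiH _) (ZjH _), DiffH.ijZb hU hV' (ZiH _) (ZjH _),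
        DiffH.ijZb hU hV' (ZiH _) (ZjH _)]
      refine DiffH.ijZZ2 hU hU' hV hV' ?_
      rw [hUd, hH]; exact hZZ1 _ _ _ _ hijlt
    · have cc : Commute (c p) (c q) := cX p _ (Hc q)
      simp only [Z'e, h'e]
      rw [DiffH.genZ (z1 _) cc, DiffH.genZ (z2 _) cc.symm, DiffH.genZ (z2 _) cc.symm, cc.eq,
        hZZ2 _ _ α β hs]
      noncomm_ring
  · intro p q α β hpq
    rcases key p q hpq with ⟨rfl, rfl⟩ | ⟨hs, -, -, -, -, -, -, z1, z2⟩
    · rw [hneg, invneg]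
      simp only [D'i, D'j]
      rw [DiffH.ijDa (DjH _), DiffH.ijDa (DjH _), DiffH.ijDb hU hW' (DiH _)]
      refine DiffH.ijDD1 hU hU' hW hW' ?_
      rw [hUd, hH]; exact hDD2 _ _ _ _ hijlt
    · have dd : Commute (d p) (d q) := dX p _ (Hd q)
      have w1 : Commute (d p * d q) (Ring.inverse (h (σ p) - h (σ q))) :=
        DiffH.comm_inv ((dX p _ (Hdiff _ _)).mul_left (dX q _ (Hdiff _ _)))
      have w2 : Commute (d p * d q) (h (σ p) - h (σ q)) :=
        (dX p _ (Hdiff _ _)).mul_left (dX q _ (Hdiff _ _))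
      have w3 := ((w2.pow_right 2).sub_right (Commute.one_right _)).mul_right (w1.pow_right 2)
      simp only [D'e, h'e]
      rw [DiffH.genD (z2 _), DiffH.genD (z2 _), DiffH.genD (z1 _), ← dd.eq,
        hDD1 _ _ α β hs, mul_add, ← mul_assoc (d p * d q) (-_),
        ← mul_assoc (d p * d q) (_ * _ ^ 2), w1.neg_right.eq, w3.eq,
        mul_assoc (-_) (d p * d q), mul_assoc (_ * _ ^ 2) (d p * d q)]
  · intro p q α β hpq
    rcases key p q hpq with ⟨rfl, rfl⟩ | ⟨hs, -, -, -, -, -, -, z1, z2⟩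
    · rw [hneg, invneg]
      simp only [D'i, D'j]
      rw [DiffH.ijDa (DjH _), DiffH.ijDb hU hW' (DiH _), DiffH.ijDb hU hW' (DiH _)]
      refine DiffH.ijDD2 hU hU' hW hW' ?_
      rw [hUd, hH]; exact hDD1 _ _ _ _ hijlt
    · have dd : Commute (d p) (d q) := dX p _ (Hd q)
      have w1 : Commute (d p * d q) (Ring.inverse (h (σ p) - h (σ q))) :=
        DiffH.comm_inv ((dX p _ (Hdiff _ _)).mul_left (dX q _ (Hdiff _ _)))
      simp only [D'e, h'e]
      rw [DiffH.genD (z2 _), DiffH.genD (z1 _), DiffH.genD (z1 _), ← dd.eq,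
        hDD2 _ _ α β hs, mul_add, ← mul_assoc, w1.eq, mul_assoc]
  · intro p q α β hpq
    rcases key p q hpq with ⟨rfl, rfl⟩ | ⟨hs, -, -, z1, z2, z3, z4, -, -⟩
    · simp only [Z'i, D'j]
      refine DiffH.ijZD1 hW (DiH _) (ZjH _) ?_
      have e : W = Ring.inverse (h p - h q + 1) := by
        rw [← hH]; exact (DiffH.inv_eq hW hW').symm
      rw [e, hH]; exact hZD2 _ _ _ _ hijlt
    · have dd : Commute (c p) (d q) := cX p _ (Hd q)
      simp only [Z'e, D'e]
      rw [DiffH.move (z4 _) (z1 _) dd, hZD1 _ _ _ _ hs]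
      noncomm_ring
  · intro p q α β hpq
    rcases key p q hpq with ⟨rfl, rfl⟩ | ⟨hs, -, -, z1, z2, z3, z4, -, -⟩
    · rw [hneg, invneg1]
      simp only [Z'j, D'i]
      exact DiffH.ijZD2 hU hU' hV hV' hX hX' (ZiH _) (DjH _) (hZD1 _ _ _ _ hijlt)
    · have dd : Commute (c q) (d p) := cX q _ (Hd p)
      simp only [Z'e, D'e, h'e]
      have w0 : Commute (d p) (h (σ p) - h (σ q)) := dX p _ (Hdiff _ _)
      have two : Commute (d p) (2 : A) := (Nat.cast_commute 2 (d p)).symm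
      have w := (w0.mul_right (w0.add_right two)).mul_right
        ((DiffH.comm_inv (w0.add_right (Commute.one_right _))).pow_right 2)
      rw [DiffH.move (z3 _) (z2 _) dd, hZD2 _ _ _ _ hs, ← mul_assoc (d p), w.eq]
      noncomm_ring
  · intro p α β
    have e : Z' p α * D' p β = Z (σ p) α * D (σ p) β := by
      rw [Z'e, D'e, mul_assoc, ← mul_assoc (c p), cd, one_mul]
    rw [e, hZDdiag]
    congr 1
    rw [← Equiv.sum_comp σ]
    refine Finset.sum_congr rfl fun m _ => ?_
    rw [h'e, h'e, Z'e, D'e]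
    congr 1
    calc D (σ m) β * Z (σ m) α = (d m * c m) * (D (σ m) β * Z (σ m) α) := by rw [dc, one_mul]
      _ = d m * (D (σ m) β * Z (σ m) α * c m) := by
        rw [mul_assoc, (cX m _ (HDZ (σ m) α β)).eq]
      _ = _ := by simp only [mul_assoc]
end

section
/- Fix i ∈ {1, …, n−1} and define new elements by the substitution q̌_i: X'^i = ℋ_{i,i+1}^{−1} X^{i+1}, X'^{i+1} = X^i ℋ_{i,i+1}, X'^j = X^j for j ≠ i, i+1; D'_i = D_{i+1} ℋ_{i,i+1}, D'_{i+1} = ℋ_{i,i+1}^{−1} D_i, D'_j = D_j for j ≠ i, i+1. Then the elements X'^1, …, X'^n, D'_1, …, D'_n again satisfy the Weyl algebra relations: X'^j X'^k = X'^k X'^j, D'_j D'_k = D'_k D'_j, and D'_j X'^k − X'^k D'_j = δ_{jk} for all j, k; that is, the Zhelobenko operator q̌_i acts by an endomorphism respecting the relations of the localized Weyl algebra. -/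
open Finset

/-- Comment 5 of Herlemont–Ogievetsky: the Zhelobenko operator `q̌_i`, acting on the
localized Weyl algebra by `X^i ↦ ℋ_{i,i+1}⁻¹ X^{i+1}`, `X^{i+1} ↦ X^i ℋ_{i,i+1}`,
`D_i ↦ D_{i+1} ℋ_{i,i+1}`, `D_{i+1} ↦ ℋ_{i,i+1}⁻¹ D_i` (and fixing the other generators),
respects the Weyl algebra relations. Here `ℋ_i = D_i X^i` and `ℋ_{ij} = ℋ_i − ℋ_j`. -/
theorem stmt15 {k B : Type*} [Field k] [CharZero k] [Ring B] [Algebra k B]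
    {n : ℕ} (hn : 1 ≤ n) (X D : Fin n → B)
    (hXX : ∀ i j, X i * X j = X j * X i)
    (hDD : ∀ i j, D i * D j = D j * D i)
    (hDX : ∀ i j, D i * X j - X j * D i = if i = j then (1 : B) else 0)
    (hHunit : ∀ (i j : Fin n) (m : ℤ), i ≠ j → IsUnit (D i * X i - (D j * X j) + (m : B)))
    (i j : Fin n) (hij : (i : ℕ) + 1 = (j : ℕ)) :
    ∀ X' D' : Fin n → B,
      X' = (fun m => if m = i then Ring.inverse (D i * X i - (D j * X j)) * X j
            else if m = j then X i * (D i * X i - (D j * X j)) else X m) →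
      D' = (fun m => if m = i then D j * (D i * X i - (D j * X j))
            else if m = j then Ring.inverse (D i * X i - (D j * X j)) * D i else D m) →
      (∀ p q, X' p * X' q = X' q * X' p) ∧
      (∀ p q, D' p * D' q = D' q * D' p) ∧
      (∀ p q, D' p * X' q - X' q * D' p = if p = q then (1 : B) else 0) := by
  intro X' D' hX' hD'
  have hne : i ≠ j := by
    intro h; rw [h] at hij; omega
  have hu0 := hHunit i j 0 hne
  have hu1 := hHunit i j 1 hne
  have cDX : ∀ p q, p ≠ q → D p * X q = X q * D p := by
    intro p q h
    have := hDX p q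
    rw [if_neg h] at this
    exact sub_eq_zero.mp this
  have eDX : ∀ p, D p * X p = X p * D p + 1 := by
    intro p
    have := hDX p p
    rw [if_pos rfl] at this
    rw [← this]; abel
  have hxx : ∀ p q, p ≠ q → (D p * X p) * X q = X q * (D p * X p) := by
    intro p q h
    rw [mul_assoc, hXX p q, ← mul_assoc, cDX p q h, mul_assoc]
  have hdd : ∀ p q, p ≠ q → (D p * X p) * D q = D q * (D p * X p) := by
    intro p q h
    rw [mul_assoc, ← cDX q p h.symm, ← mul_assoc, hDD p q, mul_assoc]
  have hxs : ∀ p, (D p * X p) * X p = X p * (D p * X p) + X p := by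
    intro p
    conv_lhs => rw [eDX p]
    noncomm_ring
  have hds : ∀ p, D p * (D p * X p) = (D p * X p) * D p + D p := by
    intro p
    conv_lhs => rw [eDX p]
    noncomm_ring
  push_cast at hu0 hu1
  rw [add_zero] at hu0
  have aH : X i * (D i * X i - D j * X j) = (D i * X i - D j * X j) * X i - X i := by
    rw [mul_sub, sub_mul, hxs i, hxx j i hne.symm]; abel
  have bH : X j * (D i * X i - D j * X j) = (D i * X i - D j * X j) * X j + X j := by
    rw [mul_sub, sub_mul, hxs j, hxx i j hne]; abel
  have pH : D i * (D i * X i - D j * X j) = (D i * X i - D j * X j) * D i + D i := by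
    rw [mul_sub, sub_mul, hds i, hdd j i hne.symm]; abel
  have qH : D j * (D i * X i - D j * X j) = (D i * X i - D j * X j) * D j - D j := by
    rw [mul_sub, sub_mul, hds j, hdd i j hne]; abel
  have xH : ∀ m, m ≠ i → m ≠ j →
      X m * (D i * X i - D j * X j) = (D i * X i - D j * X j) * X m := by
    intro m h1 h2
    rw [mul_sub, sub_mul, hxx i m h1.symm, hxx j m h2.symm]
  have dH : ∀ m, m ≠ i → m ≠ j →
      D m * (D i * X i - D j * X j) = (D i * X i - D j * X j) * D m := by
    intro m h1 h2
    rw [mul_sub, sub_mul, hdd i m h1.symm, hdd j m h2.symm]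
  have ab := hXX i j
  have pq := hDD i j
  have pb := cDX i j hne
  have qa := cDX j i hne.symm
  have pa := eDX i
  have qb := eDX j
  generalize D i * X i - D j * X j = H at *
  have GH := Ring.inverse_mul_cancel H hu0
  have HG := Ring.mul_inverse_cancel H hu0
  generalize Ring.inverse H = G at *
  obtain ⟨K, hK, hK'⟩ := isUnit_iff_exists.mp hu1
  have cG : ∀ y, y * H = H * y → y * G = G * y := by
    intro y hy
    calc y * G = (G * H) * y * G := by rw [GH, one_mul]
      _ = G * (y * H) * G := by rw [hy]; noncomm_ring
      _ = G * y * (H * G) := by noncomm_ring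
      _ = G * y := by rw [HG, mul_one]
  have sG : ∀ y, y * H = H * y + y → y * G = K * y := by
    intro y hy
    calc y * G = (K * (H + 1)) * y * G := by rw [hK', one_mul]
      _ = K * (H * y + y) * G := by noncomm_ring
      _ = K * y * (H * G) := by rw [← hy]; noncomm_ring
      _ = K * y := by rw [HG, mul_one]
  have c1 : (X j * X i) * H = H * (X j * X i) := by
    rw [mul_assoc, aH, mul_sub, ← mul_assoc, bH]; noncomm_ring
  have c2 : (D i * D j) * H = H * (D i * D j) := by
    rw [mul_assoc, qH, mul_sub, ← mul_assoc, pH]; noncomm_ring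
  have c3 : (X j * D j) * H = H * (X j * D j) := by
    rw [mul_assoc, qH, mul_sub, ← mul_assoc, bH]; noncomm_ring
  have c4 : (D i * X i) * H = H * (D i * X i) := by
    rw [mul_assoc, aH, mul_sub, ← mul_assoc, pH]; noncomm_ring
  have can : ∀ y z, (y * z) * H = H * (y * z) → (G * y) * (z * H) = y * z := by
    intro y z h
    calc (G * y) * (z * H) = G * ((y * z) * H) := by noncomm_ring
      _ = (G * H) * (y * z) := by rw [h]; noncomm_ring
      _ = y * z := by rw [GH, one_mul]
  have can' : ∀ y z, (y * H) * (G * z) = y * z := by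
    intro y z
    calc (y * H) * (G * z) = y * (H * G) * z := by noncomm_ring
      _ = y * z := by rw [HG, mul_one]
  have mG : ∀ y z, y * H = H * y → y * z = z * y → y * (G * z) = (G * z) * y := by
    intro y z h h'
    rw [← mul_assoc, cG y h, mul_assoc, h', mul_assoc]
  have mH : ∀ y z, y * H = H * y → y * z = z * y → y * (z * H) = (z * H) * y := by
    intro y z h h'
    rw [← mul_assoc, h', mul_assoc, h, mul_assoc]
  have e1 : (G * X j) * (X i * H) = (X i * H) * (G * X j) := by
    rw [can _ _ c1, can', ab]
  have e2 : (G * D i) * (D j * H) = (D j * H) * (G * D i) := by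
    rw [can _ _ c2, can', pq]
  have e3 : (D j * H) * (X i * H) = (X i * H) * (D j * H) := by
    have : D j * H * X i = X i * H * D j := by
      rw [qH, aH, sub_mul, sub_mul, mul_assoc, mul_assoc, qa]
    rw [← mul_assoc, ← mul_assoc, this]
  have e4 : (G * D i) * (G * X j) = (G * X j) * (G * D i) := by
    have : D i * G * X j = X j * G * D i := by
      rw [sG _ pH, sG _ bH, mul_assoc, mul_assoc, pb]
    rw [mul_assoc, ← mul_assoc (D i), this]; noncomm_ring
  have e5 : (D j * H) * (G * X j) - (G * X j) * (D j * H) = 1 := by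
    rw [can', can _ _ c3, qb]; abel
  have e6 : (G * D i) * (X i * H) - (X i * H) * (G * D i) = 1 := by
    rw [can', can _ _ c4, pa]; abel
  have hXi : X' i = G * X j := by simp [hX']
  have hXj : X' j = X i * H := by simp [hX', hne.symm]
  have hXm : ∀ m, m ≠ i → m ≠ j → X' m = X m := by
    intro m h1 h2; simp [hX', h1, h2]
  have hDi : D' i = D j * H := by simp [hD']
  have hDj : D' j = G * D i := by simp [hD', hne.symm]
  have hDm : ∀ m, m ≠ i → m ≠ j → D' m = D m := by
    intro m h1 h2; simp [hD', h1, h2]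
  clear hX' hD'
  have tri : ∀ m, m = i ∨ m = j ∨ (m ≠ i ∧ m ≠ j) := by intro m; tauto
  refine ⟨?_, ?_, ?_⟩
  · intro p q
    rcases tri p with rfl | rfl | ⟨h1, h2⟩ <;> rcases tri q with rfl | rfl | ⟨h3, h4⟩
    · rfl
    · rw [hXi, hXj, e1]
    · rw [hXi, hXm q h3 h4, mG _ _ (xH q h3 h4) (hXX _ _)]
    · rw [hXi, hXj, e1]
    · rfl
    · rw [hXj, hXm q h3 h4, mH _ _ (xH q h3 h4) (hXX _ _)]
    · rw [hXi, hXm p h1 h2, mG _ _ (xH p h1 h2) (hXX _ _)]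
    · rw [hXj, hXm p h1 h2, mH _ _ (xH p h1 h2) (hXX _ _)]
    · rw [hXm p h1 h2, hXm q h3 h4, hXX]
  · intro p q
    rcases tri p with rfl | rfl | ⟨h1, h2⟩ <;> rcases tri q with rfl | rfl | ⟨h3, h4⟩
    · rfl
    · rw [hDi, hDj, e2]
    · rw [hDi, hDm q h3 h4, mH _ _ (dH q h3 h4) (hDD _ _)]
    · rw [hDi, hDj, e2]
    · rfl
    · rw [hDj, hDm q h3 h4, mG _ _ (dH q h3 h4) (hDD _ _)]
    · rw [hDi, hDm p h1 h2, mH _ _ (dH p h1 h2) (hDD _ _)]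
    · rw [hDj, hDm p h1 h2, mG _ _ (dH p h1 h2) (hDD _ _)]
    · rw [hDm p h1 h2, hDm q h3 h4, hDD]
  · intro p q
    rcases tri p with rfl | rfl | ⟨h1, h2⟩ <;> rcases tri q with rfl | rfl | ⟨h3, h4⟩
    · rw [if_pos rfl, hDi, hXi, e5]
    · rw [if_neg hne, hDi, hXj, e3, sub_self]
    · rw [if_neg h3.symm, hDi, hXm q h3 h4,
        mH _ _ (xH q h3 h4) (cDX _ _ h4.symm).symm, sub_self]
    · rw [if_neg hne.symm, hDj, hXi, e4, sub_self]
    · rw [if_pos rfl, hDj, hXj, e6]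
    · rw [if_neg h4.symm, hDj, hXm q h3 h4,
        mG _ _ (xH q h3 h4) (cDX _ _ h3.symm).symm, sub_self]
    · rw [if_neg h1, hDm p h1 h2, hXi, mG _ _ (dH p h1 h2) (cDX _ _ h2), sub_self]
    · rw [if_neg h2, hDm p h1 h2, hXj, mH _ _ (dH p h1 h2) (cDX _ _ h1), sub_self]
    · rw [hDm p h1 h2, hXm q h3 h4, hDX]
end

section
/- For any t ∈ K with t − x_l ≠ 0 for all l, one has Π_{l=1}^n (t − x_l − 1)(t − x_l)^{−1} + Σ_{j=1}^n (t − x_j)^{−1} Π_{k ≠ j} (x_j − x_k − 1)(x_j − x_k)^{−1} = 1. -/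
open Finset

/-- The identity (from Note 3 after Proposition 4.3 of [KO5], used in the proof of
Lemma 3.3 of Herlemont–Ogievetsky): for pairwise distinct `x_1, …, x_n` in a field of
characteristic 0 and any `t` with `t ≠ x_l` for all `l`,
`Π_l (t − x_l − 1)/(t − x_l) + Σ_j (t − x_j)⁻¹ Π_{k ≠ j}(x_j − x_k − 1)/(x_j − x_k) = 1`. -/
theorem stmt16 {K : Type*} [Field K] [CharZero K] {n : ℕ} (hn : 1 ≤ n)
    (x : Fin n → K) (hx : ∀ i j : Fin n, i ≠ j → x i ≠ x j) :
    ∀ t : K, (∀ i, t - x i ≠ 0) →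
      (∏ i, ((t - x i - 1) / (t - x i))) +
        ∑ j, (t - x j)⁻¹ * ∏ m ∈ Finset.univ.erase j, ((x j - x m - 1) / (x j - x m)) = 1 := by
  intro t ht
  have hinj : Set.InjOn x (Finset.univ : Finset (Fin n)) := by
    intro i _ j _ h
    by_contra hne
    exact hx i j hne h
  have hdeg : (Lagrange.nodal univ x - Lagrange.nodal univ (fun i => x i + 1)).degree
      < ((univ : Finset (Fin n)).card : WithBot ℕ) := by
    have h := Polynomial.degree_sub_lt (p := Lagrange.nodal univ x)
      (q := Lagrange.nodal univ (fun i => x i + 1))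
      (by rw [Lagrange.degree_nodal, Lagrange.degree_nodal]) Lagrange.nodal_ne_zero
      (by rw [Lagrange.nodal_monic.leadingCoeff, Lagrange.nodal_monic.leadingCoeff])
    rwa [Lagrange.degree_nodal] at h
  have key := congrArg (Polynomial.eval t) (Lagrange.eq_interpolate hinj hdeg)
  rw [Lagrange.eval_interpolate_not_at_node _ (fun i _ => sub_ne_zero.mp (ht i))] at key
  have hN : (∏ i, (t - x i)) ≠ 0 := Finset.prod_ne_zero_iff.mpr fun i _ => ht i
  have hsum : ∑ j, (t - x j)⁻¹ * ∏ m ∈ Finset.univ.erase j, ((x j - x m - 1) / (x j - x m))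
      = ∑ i, Lagrange.nodalWeight univ x i * (t - x i)⁻¹ *
        Polynomial.eval (x i)
          (Lagrange.nodal univ x - Lagrange.nodal univ (fun i => x i + 1)) := by
    refine Finset.sum_congr rfl fun j _ => ?_
    rw [Polynomial.eval_sub, Lagrange.eval_nodal_at_node (mem_univ j), Lagrange.eval_nodal,
      ← Finset.mul_prod_erase univ _ (mem_univ j), Lagrange.nodalWeight, Finset.prod_div_distrib,
      Finset.prod_inv_distrib]
    simp only [← sub_sub]
    ring
  rw [hsum, Finset.prod_div_distrib]
  rw [Polynomial.eval_sub, Lagrange.eval_nodal, Lagrange.eval_nodal] at key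
  simp only [← sub_sub] at key
  rw [div_add' _ _ _ hN, div_eq_one_iff_eq hN]
  linear_combination -key
end
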